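/- Let K ⊂ U(H) be the subgroup of unitaries preserving a fixed nondegenerate bilinear form B on a finite-dimensional complex Hilbert space H (i.e., B(Ux,Uy) = B(x,y) for all x,y), where B is realized by a vector |Ψ⟩ ∈ H⊗H via B(x,y) = ⟨Ψ|(x⊗y), and suppose |Ψ⟩ spans the space of vectors invariant under {U⊗U : U ∈ K}. If V ∈ U(H) normalizes K, then V = e^{iθ}V′ for some θ ∈ ℝ and V′ ∈ K. -/

import Mathlib

open Matrix Kronecker

open scoped ComplexOrder in
/-- An eigenvalue of a unitary matrix has modulus one. -/
theorem norm_eq_one_of_unitary_mulVec_eq_smul {m : Type*} [Fintype m] [DecidableEq m]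
    {M : Matrix m m ℂ} (hM : M ∈ Matrix.unitaryGroup m ℂ) {x : m → ℂ} (hx : x ≠ 0) {c : ℂ}
    (h : M *ᵥ x = c • x) : ‖c‖ = 1 := by
  have hinner : star (M *ᵥ x) ⬝ᵥ (M *ᵥ x) = star x ⬝ᵥ x := by
    rw [star_mulVec, dotProduct_mulVec, vecMul_vecMul, ← star_eq_conjTranspose,
      Matrix.mem_unitaryGroup_iff'.1 hM, vecMul_one]
  have hx' : star x ⬝ᵥ x ≠ 0 := dotProduct_star_self_eq_zero.not.2 hx
  rw [h, star_smul, smul_dotProduct, dotProduct_smul, smul_smul, smul_eq_mul,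
    mul_eq_right₀ hx', Complex.star_def, Complex.conj_mul'] at hinner
  have hsq : ‖c‖ ^ 2 = 1 := by exact_mod_cast hinner
  exact (pow_eq_one_iff_of_nonneg (norm_nonneg c) two_ne_zero).1 hsq

/-- Let `K` be the group of unitaries on `ℂ^n` preserving the nondegenerate bilinear form
`B(x,y) = ⟨Ψ|(x⊗y)⟩` determined by a vector `Ψ ∈ H⊗H` (preservation of `B` is the
condition `(U⊗U)Ψ = Ψ`), and suppose `Ψ` spans the space of `{U⊗U : U ∈ K}`-invariant
vectors. If a unitary `V` normalizes `K`, then `V = e^{iθ} V'` with `V' ∈ K`. -/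
theorem stmt_11 (n : ℕ) (Ψ : Fin n × Fin n → ℂ)
    (hnondeg : ∀ x : Fin n → ℂ, x ≠ 0 → ∃ y : Fin n → ℂ,
      (∑ p : Fin n × Fin n, (starRingEnd ℂ) (Ψ p) * x p.1 * y p.2) ≠ 0)
    (K : Set (Matrix (Fin n) (Fin n) ℂ))
    (hK : K = {U | U ∈ Matrix.unitaryGroup (Fin n) ℂ ∧ (U ⊗ₖ U) *ᵥ Ψ = Ψ})
    (hspan : ∀ w : Fin n × Fin n → ℂ,
      (∀ U ∈ K, (U ⊗ₖ U) *ᵥ w = w) → ∃ c : ℂ, w = c • Ψ)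
    (V : Matrix (Fin n) (Fin n) ℂ) (hV : V ∈ Matrix.unitaryGroup (Fin n) ℂ)
    (hnorm : (fun U => V * U * star V) '' K = K) :
    ∃ θ : ℝ, ∃ V' ∈ K, V = Complex.exp ((θ : ℂ) * Complex.I) • V' := by
  subst hK
  have hinv : ∀ U ∈ {U | U ∈ Matrix.unitaryGroup (Fin n) ℂ ∧ (U ⊗ₖ U) *ᵥ Ψ = Ψ},
      (U ⊗ₖ U) *ᵥ ((V ⊗ₖ V) *ᵥ Ψ) = (V ⊗ₖ V) *ᵥ Ψ := by
    intro U hU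
    rw [← hnorm] at hU
    obtain ⟨U', ⟨-, hU'⟩, rfl⟩ := hU
    have hcomm : V * U' * star V * V = V * U' := by
      rw [mul_assoc, Matrix.mem_unitaryGroup_iff'.1 hV, mul_one]
    rw [mulVec_mulVec, ← mul_kronecker_mul, hcomm, mul_kronecker_mul, ← mulVec_mulVec, hU']
  obtain ⟨c, hc⟩ := hspan _ hinv
  obtain ⟨d, hd, hdc⟩ : ∃ d : ℂ, ‖d‖ = 1 ∧ (V ⊗ₖ V) *ᵥ Ψ = d • Ψ := by
    by_cases hΨ : Ψ = 0
    · exact ⟨1, norm_one, by simp [hΨ]⟩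
    · exact ⟨c, norm_eq_one_of_unitary_mulVec_eq_smul
        (kronecker_mem_unitary hV hV) hΨ hc, hc⟩
  obtain ⟨φ, rfl⟩ := (Complex.norm_eq_one_iff d).1 hd
  set e : ℂ := Complex.exp (((-(φ / 2) : ℝ) : ℂ) * Complex.I) with he
  have hsq : e * e * Complex.exp (φ * Complex.I) = 1 := by
    rw [he, ← Complex.exp_add, ← Complex.exp_add, ← Complex.exp_zero]
    congr 1
    push_cast
    ring
  have hinv' : Complex.exp (((φ / 2 : ℝ) : ℂ) * Complex.I) * e = 1 := by
    rw [he, ← Complex.exp_add, ← Complex.exp_zero]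
    congr 1
    push_cast
    ring
  have hnorm_e : star e * e = 1 := by
    rw [Complex.star_def, Complex.conj_mul', he, Complex.norm_exp_ofReal_mul_I]
    simp
  refine ⟨φ / 2, e • V, ⟨?_, ?_⟩, ?_⟩
  · rw [Matrix.mem_unitaryGroup_iff', star_smul, smul_mul_smul_comm, hnorm_e,
      Matrix.mem_unitaryGroup_iff'.1 hV, one_smul]
  · rw [smul_kronecker, kronecker_smul, smul_smul, smul_mulVec, hdc, smul_smul, hsq, one_smul]
  · rw [smul_smul, hinv', one_smul]
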